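/- Let L : ℝⁿ × ℝⁿ × ℝ → ℝ be smooth and hyper-regular, meaning the Legendre transform Leg(q, q̇, z) = (q, ∂L/∂q̇(q, q̇, z), z) is a diffeomorphism of ℝⁿ × ℝⁿ × ℝ onto itself, and define H := E_L ∘ Leg⁻¹ where E_L(q, q̇, z) = Σᵢ q̇ⁱ ∂L/∂q̇ⁱ − L. Let q : ℝ → ℝⁿ be twice continuously differentiable and z : ℝ → ℝ continuously differentiable with z'(t) = L(q(t), q'(t), z(t)). Then (q, z) satisfies the Herglotz equations d/dt(∂L/∂q̇ⁱ) = ∂L/∂qⁱ + (∂L/∂q̇ⁱ)(∂L/∂z) if and only if the curve ξ(t) = (q(t), p(t), z(t)) with pᵢ(t) = ∂L/∂q̇ⁱ(q(t), q'(t), z(t)) satisfies the contact Hamilton equations q'ⁱ = ∂H/∂pᵢ(ξ), p'ᵢ = −∂H/∂qⁱ(ξ) − pᵢ ∂H/∂z(ξ). -/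

import Mathlib

open scoped BigOperators

/-- Partial derivative with respect to the first (position) slot. -/
noncomputable def pQ {n : ℕ} (F : (Fin n → ℝ) → (Fin n → ℝ) → ℝ → ℝ) (i : Fin n)
    (a b : Fin n → ℝ) (c : ℝ) : ℝ :=
  fderiv ℝ (fun x => F x b c) a (Pi.single i 1)

/-- Partial derivative with respect to the second (velocity/momentum) slot. -/
noncomputable def pV {n : ℕ} (F : (Fin n → ℝ) → (Fin n → ℝ) → ℝ → ℝ) (i : Fin n)
    (a b : Fin n → ℝ) (c : ℝ) : ℝ :=
  fderiv ℝ (fun v => F a v c) b (Pi.single i 1)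

/-- Partial derivative with respect to the third (action) slot. -/
noncomputable def pZ {n : ℕ} (F : (Fin n → ℝ) → (Fin n → ℝ) → ℝ → ℝ)
    (a b : Fin n → ℝ) (c : ℝ) : ℝ :=
  deriv (fun s => F a b s) c

/-- The Legendre transform `Leg(q, q̇, z) = (q, ∂L/∂q̇, z)`. -/
noncomputable def legendre {n : ℕ} (L : (Fin n → ℝ) → (Fin n → ℝ) → ℝ → ℝ)
    (m : (Fin n → ℝ) × (Fin n → ℝ) × ℝ) : (Fin n → ℝ) × (Fin n → ℝ) × ℝ :=
  (m.1, fun i => pV L i m.1 m.2.1 m.2.2, m.2.2)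

/-- The energy `E_L = Σᵢ q̇ⁱ ∂L/∂q̇ⁱ − L`. -/
noncomputable def energy {n : ℕ} (L : (Fin n → ℝ) → (Fin n → ℝ) → ℝ → ℝ)
    (a b : Fin n → ℝ) (c : ℝ) : ℝ :=
  (∑ i, b i * pV L i a b c) - L a b c

/-- The function on `ℝⁿ × ℝⁿ × ℝ` associated with a curried function. -/
def uncurry₃ {n : ℕ} (F : (Fin n → ℝ) → (Fin n → ℝ) → ℝ → ℝ)
    (m : (Fin n → ℝ) × (Fin n → ℝ) × ℝ) : ℝ :=
  F m.1 m.2.1 m.2.2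

section Partials

variable {n : ℕ} {F : (Fin n → ℝ) → (Fin n → ℝ) → ℝ → ℝ} {a b : Fin n → ℝ} {c : ℝ}
  {F' : (Fin n → ℝ) × (Fin n → ℝ) × ℝ →L[ℝ] ℝ}

lemma HasFDerivAt.pQ_eq (hF : HasFDerivAt (uncurry₃ F) F' (a, b, c)) (i : Fin n) :
    pQ F i a b c = F' (Pi.single i 1, 0, 0) := by
  have h : HasFDerivAt (fun x : Fin n → ℝ => (x, b, c)) _ a :=
    (hasFDerivAt_id (𝕜 := ℝ) a).prodMk (hasFDerivAt_const (b, c) a)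
  have h2 : HasFDerivAt (fun x => F x b c) _ a := HasFDerivAt.comp (g := uncurry₃ F) a hF h
  rw [pQ, h2.fderiv]
  rfl

lemma HasFDerivAt.pV_eq (hF : HasFDerivAt (uncurry₃ F) F' (a, b, c)) (i : Fin n) :
    pV F i a b c = F' (0, Pi.single i 1, 0) := by
  have h : HasFDerivAt (fun v : Fin n → ℝ => (a, v, c)) _ b :=
    (hasFDerivAt_const (𝕜 := ℝ) a b).prodMk
      ((hasFDerivAt_id (𝕜 := ℝ) b).prodMk (hasFDerivAt_const c b))
  have h2 : HasFDerivAt (fun v => F a v c) _ b := HasFDerivAt.comp (g := uncurry₃ F) b hF h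
  rw [pV, h2.fderiv]
  rfl

lemma HasFDerivAt.pZ_eq (hF : HasFDerivAt (uncurry₃ F) F' (a, b, c)) :
    pZ F a b c = F' (0, 0, 1) := by
  have h : HasDerivAt (fun s : ℝ => (a, b, s)) (0, 0, 1) c :=
    (hasDerivAt_const c a).prodMk ((hasDerivAt_const c b).prodMk (hasDerivAt_id c))
  have h2 : HasDerivAt (fun s => F a b s) _ c :=
    HasFDerivAt.comp_hasDerivAt (l := uncurry₃ F) c hF h
  exact h2.deriv

lemma HasFDerivAt.sum_mul_pV (hF : HasFDerivAt (uncurry₃ F) F' (a, b, c)) (w : Fin n → ℝ) :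
    F' (0, w, 0) = ∑ i, w i * pV F i a b c := by
  simp_rw [hF.pV_eq]
  have hw : w = ∑ i, w i • Pi.single i (1 : ℝ) := pi_eq_sum_univ' w
  have h := congrArg (F'.toLinearMap ∘ₗ LinearMap.inr ℝ (Fin n → ℝ) ((Fin n → ℝ) × ℝ) ∘ₗ
      LinearMap.inl ℝ (Fin n → ℝ) ℝ) hw
  simp only [map_sum, map_smul, smul_eq_mul] at h
  exact h

/-- The fibre derivatives of a smooth function are continuously differentiable. -/
lemma contDiff_pV (hF : ContDiff ℝ (⊤ : ℕ∞) (uncurry₃ F)) (i : Fin n) :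
    ContDiff ℝ 1 (uncurry₃ (pV F i)) := by
  have h : uncurry₃ (pV F i) = fun m => fderiv ℝ (uncurry₃ F) m (0, Pi.single i 1, 0) := by
    funext m
    exact ((hF.differentiable (by simp)) m).hasFDerivAt.pV_eq i
  rw [h]
  exact (hF.fderiv_right (m := 1) (by norm_cast)).clm_apply contDiff_const

end Partials

section Legendre

variable {n : ℕ} {L H : (Fin n → ℝ) → (Fin n → ℝ) → ℝ → ℝ}
  {Leginv : (Fin n → ℝ) × (Fin n → ℝ) × ℝ → (Fin n → ℝ) × (Fin n → ℝ) × ℝ}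

/-- The differential of the Hamiltonian: the terms containing the derivative of the velocity
as a function of the momentum cancel. -/
lemma hasFDerivAt_hamiltonian
    (hL : Differentiable ℝ (uncurry₃ L)) (hinv : Differentiable ℝ Leginv)
    (hleft : Function.LeftInverse Leginv (legendre L))
    (hright : Function.RightInverse Leginv (legendre L))
    (hH : ∀ (a p : Fin n → ℝ) (c : ℝ),
      H a p c = energy L (Leginv (a, p, c)).1 (Leginv (a, p, c)).2.1 (Leginv (a, p, c)).2.2)
    (m : (Fin n → ℝ) × (Fin n → ℝ) × ℝ) :
    ∃ H' : (Fin n → ℝ) × (Fin n → ℝ) × ℝ →L[ℝ] ℝ,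
      HasFDerivAt (uncurry₃ H) H' (legendre L m) ∧
      ∀ x y s, H' (x, y, s) = (∑ i, y i * m.2.1 i) - fderiv ℝ (uncurry₃ L) m (x, 0, s) := by
  have hfst (k) : (Leginv k).1 = k.1 := congrArg (fun k => k.1) (hright k :)
  have hthd (k) : (Leginv k).2.2 = k.2.2 :=
    congrArg (fun k => k.2.2) (hright k :)
  have hmom (k) (i : Fin n) :
      pV L i (Leginv k).1 (Leginv k).2.1 (Leginv k).2.2 = k.2.1 i :=
    congrArg (fun k => k.2.1 i) (hright k :)
  have hHeq : uncurry₃ H = fun k => (∑ i, (Leginv k).2.1 i * k.2.1 i) - uncurry₃ L (Leginv k) := by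
    funext k
    simp only [uncurry₃, hH, energy, Prod.mk.eta, hmom]
  set k₀ := legendre L m
  have hm : Leginv k₀ = m := hleft m
  obtain ⟨D, hD⟩ : ∃ D, HasFDerivAt Leginv D k₀ := ⟨_, (hinv k₀).hasFDerivAt⟩
  have hLm : HasFDerivAt (uncurry₃ L) (fderiv ℝ (uncurry₃ L) m) (Leginv k₀) := by
    rw [hm]; exact (hL m).hasFDerivAt
  have hD1 (w) : (D w).1 = w.1 := by
    have h1 : HasFDerivAt (fun k => (Leginv k).1) _ k₀ := hD.fst
    simp only [hfst] at h1
    exact congrArg (fun T => T w) (h1.unique hasFDerivAt_fst)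
  have hD3 (w) : (D w).2.2 = w.2.2 := by
    have h1 : HasFDerivAt (fun k => (Leginv k).2.2) _ k₀ := hD.snd.snd
    simp only [hthd] at h1
    exact congrArg (fun T => T w) (h1.unique hasFDerivAt_snd.snd)
  have hV (i : Fin n) := hasFDerivAt_pi'.1 hD.snd.fst i
  have hP (i : Fin n) :=
    hasFDerivAt_pi'.1 (hasFDerivAt_id (𝕜 := ℝ) k₀).snd.fst i
  have hsum := HasFDerivAt.fun_sum (u := Finset.univ) fun i _ => (hV i).mul (hP i)
  rw [hHeq]
  refine ⟨_, hsum.sub (hLm.comp k₀ hD), fun x y s => ?_⟩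
  have hsplit : D (x, y, s) = (x, 0, s) + (0, (D (x, y, s)).2.1, 0) := by
    ext <;> simp [hD1, hD3]
  have hfib := (hL m).hasFDerivAt.sum_mul_pV (D (x, y, s)).2.1
  have hk (i : Fin n) : k₀.2.1 i = pV L i m.1 m.2.1 m.2.2 := rfl
  have hval : fderiv ℝ (uncurry₃ L) m (D (x, y, s)) = fderiv ℝ (uncurry₃ L) m (x, 0, s) +
      ∑ i, (D (x, y, s)).2.1 i * k₀.2.1 i := by
    rw [hsplit, map_add, ← hsplit]
    simp only [hk, hfib]
  simp [hval, hm, Finset.sum_add_distrib]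
  simp only [mul_comm]
  ring

end Legendre

/-- For a hyper-regular action-dependent Lagrangian, a curve satisfies the Herglotz
equations if and only if its Legendre transform satisfies the contact Hamilton
equations for `H = E_L ∘ Leg⁻¹`. -/
theorem herglotz_iff_contact_hamilton {n : ℕ}
    (L : (Fin n → ℝ) → (Fin n → ℝ) → ℝ → ℝ)
    (hL : ContDiff ℝ (⊤ : ℕ∞) (fun m : (Fin n → ℝ) × (Fin n → ℝ) × ℝ => L m.1 m.2.1 m.2.2))
    (Leginv : (Fin n → ℝ) × (Fin n → ℝ) × ℝ → (Fin n → ℝ) × (Fin n → ℝ) × ℝ)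
    (hLeginv_smooth : ContDiff ℝ (⊤ : ℕ∞) Leginv)
    (hleft : Function.LeftInverse Leginv (legendre L))
    (hright : Function.RightInverse Leginv (legendre L))
    (H : (Fin n → ℝ) → (Fin n → ℝ) → ℝ → ℝ)
    (hHdef : ∀ (a p : Fin n → ℝ) (c : ℝ),
      H a p c = energy L (Leginv (a, p, c)).1 (Leginv (a, p, c)).2.1 (Leginv (a, p, c)).2.2)
    (q : ℝ → (Fin n → ℝ)) (z : ℝ → ℝ)
    (hq : ContDiff ℝ 2 q) (hz : ContDiff ℝ 1 z)
    (hzeq : ∀ t, deriv z t = L (q t) (deriv q t) (z t))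
    (p : ℝ → (Fin n → ℝ))
    (hpdef : ∀ t i, p t i = pV L i (q t) (deriv q t) (z t)) :
    (∀ (i : Fin n) (t : ℝ),
      deriv (fun s => pV L i (q s) (deriv q s) (z s)) t
        = pQ L i (q t) (deriv q t) (z t)
          + pV L i (q t) (deriv q t) (z t) * pZ L (q t) (deriv q t) (z t))
    ↔ (∀ (i : Fin n) (t : ℝ),
        deriv q t i = pV H i (q t) (p t) (z t)
        ∧ deriv p t i
            = -(pQ H i (q t) (p t) (z t)) - p t i * pZ H (q t) (p t) (z t)) := by
  have hLd : Differentiable ℝ (uncurry₃ L) := hL.differentiable (by simp)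
  have hleg (t : ℝ) : legendre L (q t, deriv q t, z t) = (q t, p t, z t) := by
    simp only [legendre, ← hpdef]
  have hdp (i : Fin n) : Differentiable ℝ fun t => p t i := by
    have hq' : ContDiff ℝ 1 (deriv q) := hq.deriv'
    simp only [hpdef]
    exact ((contDiff_pV hL i).comp ((hq.of_le one_le_two).prodMk (hq'.prodMk hz))).differentiable
      one_ne_zero
  have hderiv (i : Fin n) (t : ℝ) :
      deriv (fun s => pV L i (q s) (deriv q s) (z s)) t = deriv p t i := by
    rw [deriv_pi fun i => hdp i t]
    simp only [hpdef]
  rw [forall_comm, forall_comm (α := Fin n)]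
  refine forall_congr' fun t => forall_congr' fun i => ?_
  obtain ⟨H', hH', hval⟩ := hasFDerivAt_hamiltonian hLd
    (hLeginv_smooth.differentiable (by simp)) hleft hright hHdef (q t, deriv q t, z t)
  rw [hleg] at hH'
  have hLt := (hLd (q t, deriv q t, z t)).hasFDerivAt
  have hz0 : fderiv ℝ (uncurry₃ L) (q t, deriv q t, z t) (0, 0, 0) = 0 := map_zero _
  have h1 : pV H i (q t) (p t) (z t) = deriv q t i := by
    rw [hH'.pV_eq, hval, hz0]
    simp [Pi.single_apply]
  have h2 : pQ H i (q t) (p t) (z t) = -pQ L i (q t) (deriv q t) (z t) := by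
    rw [hH'.pQ_eq, hLt.pQ_eq, hval]
    simp
  have h3 : pZ H (q t) (p t) (z t) = -pZ L (q t) (deriv q t) (z t) := by
    rw [hH'.pZ_eq, hLt.pZ_eq, hval]
    simp
  rw [hderiv, h1, h2, h3, hpdef t i]
  simp
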